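/- Let D be a discriminant form of exponent a power of 2 and γ ∈ D. If e^γ ∈ im(↑), then γ^⊥ contains at least two distinct isotropic subgroups of order 2. -/

import Mathlib

open scoped Classical BigOperators

noncomputable section

/-- The bilinear form associated to a quadratic form `q : D → ℚ/ℤ`. -/
def bil {D : Type*} [AddCommGroup D] (q : D → AddCircle (1 : ℚ)) (x y : D) :
    AddCircle (1 : ℚ) :=
  q (x + y) - q x - q y

/-- The standard basis vector `e^γ` of `ℂ[D]`. -/
def eV {D : Type*} (γ : D) : D → ℂ := fun β => if β = γ then 1 else 0

/-- `↑_H(e^{γ+H}) = ∑_{μ ∈ H} e^{γ+μ}`, as an element of `ℂ[D]`. -/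
def liftVec {D : Type*} [AddCommGroup D] (H : AddSubgroup D) (γ : D) : D → ℂ :=
  fun β => if β - γ ∈ H then 1 else 0

/-- `im(↑) = ∑_H im(↑_H)`, the span of all isotropic lifts over nontrivial
isotropic subgroups `H` of `D`. -/
def imUp {D : Type*} [AddCommGroup D] (q : D → AddCircle (1 : ℚ)) :
    Submodule ℂ (D → ℂ) :=
  Submodule.span ℂ
    {v | ∃ H : AddSubgroup D, H ≠ ⊥ ∧ (∀ x ∈ H, q x = 0) ∧
      ∃ γ : D, (∀ μ ∈ H, bil q γ μ = 0) ∧ v = liftVec H γ}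

/-- A nonzero element of order two on which `q` vanishes. -/
def IsIsotropicInvolution {D : Type*} [AddCommGroup D] (q : D → AddCircle (1 : ℚ)) (x : D) :
    Prop :=
  x ≠ 0 ∧ x + x = 0 ∧ q x = 0

/-- A circle has only one point of order two. -/
theorem AddCircle.eq_of_add_self_eq_zero {a b : AddCircle (1 : ℚ)} (ha : a + a = 0)
    (hb : b + b = 0) (ha0 : a ≠ 0) (hb0 : b ≠ 0) : a = b := by
  induction a using QuotientAddGroup.induction_on with | H x => ?_
  induction b using QuotientAddGroup.induction_on with | H y => ?_
  have key : ∀ z : ℚ, (z : AddCircle (1 : ℚ)) + z = 0 → (z : AddCircle (1 : ℚ)) ≠ 0 →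
      ∃ m : ℤ, z = m + 1 / 2 := by
    intro z hz hz0
    rw [← AddCircle.coe_add, AddCircle.coe_eq_zero_iff] at hz
    obtain ⟨n, hn⟩ := hz
    rcases Int.even_or_odd' n with ⟨m, rfl | rfl⟩
    · refine absurd ((AddCircle.coe_eq_zero_iff _).2 ⟨m, ?_⟩) hz0
      simp only [zsmul_eq_mul, mul_one] at hn ⊢
      push_cast at hn
      linarith
    · refine ⟨m, ?_⟩
      simp only [zsmul_eq_mul, mul_one] at hn
      push_cast at hn
      linarith
  obtain ⟨m, rfl⟩ := key x ha ha0
  obtain ⟨n, rfl⟩ := key y hb hb0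
  refine sub_eq_zero.1 ?_
  change (((m + 1 / 2 : ℚ) - (n + 1 / 2 : ℚ) : ℚ) : AddCircle (1 : ℚ)) = 0
  refine (AddCircle.coe_eq_zero_iff _).2 ⟨m - n, ?_⟩
  simp

section QuadraticForm

variable {D : Type*} [AddCommGroup D] {q : D → AddCircle (1 : ℚ)}

theorem bil_comm (x y : D) : bil q x y = bil q y x := by
  simp only [bil, add_comm x y]
  abel

theorem bil_add_right (hbil : ∀ x y z : D, bil q (x + y) z = bil q x z + bil q y z)
    (x y z : D) : bil q x (y + z) = bil q x y + bil q x z := by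
  rw [bil_comm, hbil, bil_comm y, bil_comm z]

theorem apply_add_eq_add_bil (x y : D) : q (x + y) = q x + q y + bil q x y := by
  simp only [bil]
  abel

theorem bil_zero_right (hbil : ∀ x y z : D, bil q (x + y) z = bil q x z + bil q y z)
    (x : D) : bil q x 0 = 0 := by
  have := bil_add_right hbil x 0 0
  simpa using this

theorem apply_zero (hbil : ∀ x y z : D, bil q (x + y) z = bil q x z + bil q y z) :
    q 0 = 0 := by
  have := bil_zero_right hbil (0 : D)
  simpa [bil] using this

namespace IsIsotropicInvolution

variable {x y : D}

theorem bil_add_self (hbil : ∀ x y z : D, bil q (x + y) z = bil q x z + bil q y z)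
    (hx : IsIsotropicInvolution q x) (z : D) : bil q z x + bil q z x = 0 := by
  rw [← bil_add_right hbil, hx.2.1, bil_zero_right hbil]

theorem bil_self (hbil : ∀ x y z : D, bil q (x + y) z = bil q x z + bil q y z)
    (hx : IsIsotropicInvolution q x) : bil q x x = 0 := by
  simp [bil, hx.2.1, hx.2.2, apply_zero hbil]

theorem eq_zero_or_eq_of_mem_zmultiples (hx : IsIsotropicInvolution q x)
    (hy : y ∈ AddSubgroup.zmultiples x) : y = 0 ∨ y = x := by
  obtain ⟨n, rfl⟩ := AddSubgroup.mem_zmultiples_iff.1 hy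
  have h2 : (2 : ℤ) • x = 0 := by rw [two_zsmul, hx.2.1]
  rcases Int.even_or_odd' n with ⟨m, rfl | rfl⟩
  · left
    rw [mul_comm, mul_zsmul, h2, zsmul_zero]
  · right
    rw [add_zsmul, mul_comm, mul_zsmul, h2, zsmul_zero, zero_add, one_zsmul]

theorem card_zmultiples (hx : IsIsotropicInvolution q x) :
    Nat.card (AddSubgroup.zmultiples x) = 2 := by
  rw [Nat.card_zmultiples]
  exact addOrderOf_eq_prime (by rw [two_nsmul, hx.2.1]) hx.1

end IsIsotropicInvolution

/-- A nontrivial isotropic subgroup of a `2`-group contains an isotropic involution. -/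
theorem exists_isIsotropicInvolution_mem (hexp : ∃ k : ℕ, ∀ x : D, 2 ^ k • x = 0)
    {H : AddSubgroup D} (hH : H ≠ ⊥) (hq : ∀ x ∈ H, q x = 0) :
    ∃ x ∈ H, IsIsotropicInvolution q x := by
  obtain ⟨x, hxH, hx0⟩ := H.bot_or_exists_ne_zero.resolve_left hH
  have hex : ∃ k : ℕ, 2 ^ k • x = 0 := hexp.imp fun k hk => hk x
  have hspec := Nat.find_spec hex
  have hpos : Nat.find hex ≠ 0 := by
    intro h
    rw [h] at hspec
    exact hx0 (by simpa using hspec)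
  obtain ⟨k, hk⟩ := Nat.exists_eq_succ_of_ne_zero hpos
  have hmem : 2 ^ k • x ∈ H := H.nsmul_mem hxH _
  refine ⟨2 ^ k • x, hmem, Nat.find_min hex (by omega), ?_, hq _ hmem⟩
  rw [hk] at hspec
  rw [← two_nsmul, ← mul_nsmul', ← pow_succ']
  exact hspec

/-- If `μ` is the only isotropic involution in `γ^⊥`, every walk of length two starting at `γ + μ`
in the graph joining `β` to `β + ρ`, for isotropic involutions `ρ ∈ β^⊥`, is closed. -/
theorem eq_of_bil_eq_zero (hbil : ∀ x y z : D, bil q (x + y) z = bil q x z + bil q y z)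
    {γ μ ν ρ : D} (hμ : IsIsotropicInvolution q μ) (hγμ : bil q γ μ = 0)
    (huniq : ∀ x, IsIsotropicInvolution q x → bil q γ x = 0 → x = μ)
    (hν : IsIsotropicInvolution q ν) (hρ : IsIsotropicInvolution q ρ)
    (h₁ : bil q (γ + μ) ν = 0) (h₂ : bil q (γ + μ + ν) ρ = 0) : ρ = ν := by
  have heq {x y z w : D} (hy : IsIsotropicInvolution q y) (hw : IsIsotropicInvolution q w)
      (h : bil q x y ≠ 0) (h' : bil q z w ≠ 0) : bil q x y = bil q z w :=
    AddCircle.eq_of_add_self_eq_zero (hy.bil_add_self hbil x) (hw.bil_add_self hbil z) h h'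
  rw [hbil] at h₁
  rw [hbil, hbil] at h₂
  by_cases hγν : bil q γ ν = 0
  · obtain rfl := huniq ν hν hγν
    rw [add_assoc, hρ.bil_add_self hbil, add_zero] at h₂
    exact huniq ρ hρ h₂
  have hμν : bil q μ ν ≠ 0 := fun h => hγν (by simpa [h] using h₁)
  by_cases hγρ : bil q γ ρ = 0
  · obtain rfl := huniq ρ hρ hγρ
    rw [hγρ, hρ.bil_self hbil, bil_comm ν] at h₂
    exact absurd (by simpa using h₂) hμν
  have hγ := heq hρ hν hγρ hγν
  by_cases hμρ : bil q μ ρ = 0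
  · have hνρ : bil q ν ρ ≠ 0 := fun h => hγρ (by simpa [h, hμρ] using h₂)
    have hσ : μ + (ν + ρ) = 0 ∨ μ + (ν + ρ) = μ := by
      refine or_iff_not_imp_left.2 fun h0 => huniq _ ⟨h0, ?_, ?_⟩ ?_
      · rw [add_add_add_comm, add_add_add_comm ν, hμ.2.1, hν.2.1, hρ.2.1, add_zero, add_zero]
      · rw [apply_add_eq_add_bil (q := q), apply_add_eq_add_bil (q := q), bil_add_right hbil,
          hμ.2.2, hν.2.2, hρ.2.2, hμρ, heq hρ hν hνρ hμν]
        simpa using hν.bil_add_self hbil μ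
      · rw [bil_add_right hbil, bil_add_right hbil, hγμ, hγ, zero_add, hν.bil_add_self hbil]
    rcases hσ with h | h
    · refine absurd ?_ hμν
      have := congrArg (bil q μ) h
      rwa [bil_add_right hbil, bil_add_right hbil, hμ.bil_self hbil, hμρ, zero_add, add_zero,
        bil_zero_right hbil] at this
    · have h0 : ρ + ν = ν + ν := by rw [hν.2.1, add_comm, add_eq_left.1 h]
      exact add_right_cancel h0
  · have hνρ : bil q ν ρ = 0 := by
      rwa [hγ, heq hρ hν hμρ hμν, h₁, zero_add] at h₂
    by_cases h0 : ν + ρ = 0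
    · have h0 : ρ + ν = ν + ν := by rw [hν.2.1, add_comm, h0]
      exact add_right_cancel h0
    · have hσ := huniq (ν + ρ) ⟨h0, by rw [add_add_add_comm, hν.2.1, hρ.2.1, add_zero],
        by rw [apply_add_eq_add_bil (q := q), hν.2.2, hρ.2.2, hνρ, add_zero, add_zero]⟩
        (by rw [bil_add_right hbil, hγ, hν.bil_add_self hbil])
      refine absurd ?_ hμν
      rw [← hσ, bil_comm, bil_add_right hbil, hν.bil_self hbil, hνρ, add_zero]

/-- If `γ^⊥` contains at most one isotropic involution, then some function on `D` that is nonzero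
at `γ` changes sign along every translation `β ↦ β + ρ` by an isotropic involution `ρ ∈ β^⊥`. -/
theorem exists_alternating (hbil : ∀ x y z : D, bil q (x + y) z = bil q x z + bil q y z)
    {γ : D} (huniq : ∀ x y, IsIsotropicInvolution q x → IsIsotropicInvolution q y →
      bil q γ x = 0 → bil q γ y = 0 → x = y) :
    ∃ f : D → ℂ, f γ = 1 ∧
      ∀ β ρ, IsIsotropicInvolution q ρ → bil q β ρ = 0 → f (β + ρ) = -f β := by
  have back {β ρ : D} (hρ : IsIsotropicInvolution q ρ) (h : bil q β ρ = 0) :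
      β + ρ + ρ = β ∧ bil q (β + ρ) ρ = 0 :=
    ⟨by rw [add_assoc, hρ.2.1, add_zero], by rw [hbil, h, hρ.bil_self hbil, add_zero]⟩
  by_cases hex : ∃ μ, IsIsotropicInvolution q μ ∧ bil q γ μ = 0
  · obtain ⟨μ, hμ, hγμ⟩ := hex
    let N : Set D := {x | ∃ ν, IsIsotropicInvolution q ν ∧ bil q (γ + μ) ν = 0 ∧ x = γ + μ + ν}
    have hN : ∀ β ρ, IsIsotropicInvolution q ρ → bil q β ρ = 0 → β ∈ N → β + ρ = γ + μ := by
      rintro _ ρ hρ h ⟨ν, hν, hν', rfl⟩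
      rw [eq_of_bil_eq_zero hbil hμ hγμ (fun x hx hx' => huniq x μ hx hμ hx' hγμ) hν hρ hν' h]
      exact (back hν hν').1
    have hcN : γ + μ ∉ N := by
      rintro ⟨ν, hν, -, h⟩
      exact hν.1 (left_eq_add.1 h)
    have hγN : γ ∈ N := ⟨μ, hμ, (back hμ hγμ).2, (back hμ hγμ).1.symm⟩
    refine ⟨fun x => if x = γ + μ then -1 else if x ∈ N then 1 else 0, ?_, ?_⟩
    · have : γ ≠ γ + μ := fun h => hμ.1 (left_eq_add.1 h)
      simp [this, hγN]
    · intro β ρ hρ h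
      obtain ⟨hb, hb'⟩ := back hρ h
      have e1 : β ∈ N ↔ β + ρ = γ + μ := by
        refine ⟨hN β ρ hρ h, fun e => ⟨ρ, hρ, ?_, ?_⟩⟩
        · rwa [← e]
        · rw [← e, hb]
      have e2 : β + ρ ∈ N ↔ β = γ + μ := by
        refine ⟨fun e => ?_, fun e => ⟨ρ, hρ, e ▸ h, by rw [e]⟩⟩
        rw [← hN _ ρ hρ hb' e, hb]
      by_cases c1 : β = γ + μ
      · have c2 : β + ρ ≠ γ + μ := fun c2 => hcN (c1 ▸ e1.2 c2)
        simp only [if_neg c2, if_pos (e2.2 c1), if_pos c1, neg_neg]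
      · by_cases c2 : β + ρ = γ + μ
        · simp only [if_pos c2, if_neg c1, if_pos (e1.2 c2)]
        · simp only [if_neg c2, if_neg c1, if_neg (mt e1.1 c2), if_neg (mt e2.1 c1), neg_zero]
  · refine ⟨fun x => if x = γ then 1 else 0, if_pos rfl, fun β ρ hρ h => ?_⟩
    have c1 : β ≠ γ := by
      rintro rfl
      exact hex ⟨ρ, hρ, h⟩
    have c2 : β + ρ ≠ γ := by
      rintro rfl
      exact hex ⟨ρ, hρ, (back hρ h).2⟩
    simp [c1, c2]

/-- Functions alternating along translations by isotropic involutions are orthogonal to the image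
of the isotropic lifts. -/
theorem sum_mul_eq_zero_of_mem_imUp [Fintype D]
    (hbil : ∀ x y z : D, bil q (x + y) z = bil q x z + bil q y z)
    (hexp : ∃ k : ℕ, ∀ x : D, 2 ^ k • x = 0) {f : D → ℂ}
    (hf : ∀ β ρ, IsIsotropicInvolution q ρ → bil q β ρ = 0 → f (β + ρ) = -f β)
    {v : D → ℂ} (hv : v ∈ imUp q) : ∑ β, f β * v β = 0 := by
  induction hv using Submodule.span_induction with
  | mem v hv =>
    obtain ⟨H, hH, hq, δ, hδ, rfl⟩ := hv
    obtain ⟨ρ, hρH, hρ⟩ := exists_isIsotropicInvolution_mem hexp hH hq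
    have hneg : ∀ β, f (β + ρ) * liftVec H δ (β + ρ) = -(f β * liftVec H δ β) := by
      intro β
      have hmem : β + ρ - δ ∈ H ↔ β - δ ∈ H := by
        rw [add_sub_right_comm, H.add_mem_cancel_right hρH]
      by_cases hβ : β - δ ∈ H
      · have hperp : bil q β ρ = 0 := by
          have h0 : bil q (β - δ) ρ = 0 := by
            rw [bil, hq _ hβ, hq _ hρH, hq _ (H.add_mem hβ hρH), sub_zero, sub_zero]
          rw [← sub_add_cancel β δ, hbil, h0, hδ ρ hρH, add_zero]
        simp only [liftVec, if_pos hβ, if_pos (hmem.2 hβ), hf β ρ hρ hperp, mul_one]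
      · simp only [liftVec, if_neg hβ, if_neg (mt hmem.1 hβ), mul_zero, neg_zero]
    have hsum := Equiv.sum_comp (Equiv.addRight ρ) fun β => f β * liftVec H δ β
    simp only [Equiv.coe_addRight, hneg, Finset.sum_neg_distrib] at hsum
    exact self_eq_neg.1 hsum.symm
  | zero => simp
  | add v w _ _ hv hw => simp only [Pi.add_apply, mul_add, Finset.sum_add_distrib, hv, hw, add_zero]
  | smul c v _ hv =>
    simp only [Pi.smul_apply, smul_eq_mul, mul_left_comm _ c, ← Finset.mul_sum, hv, mul_zero]

end QuadraticForm

/-- Let `D` be a discriminant form of exponent a power of `2` and `γ ∈ D`.  If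
`e^γ ∈ im(↑)`, then `γ^⊥` contains at least two distinct isotropic subgroups of
order `2`. -/
theorem two_isotropic_of_basisVec_mem_imUp_two
    {D : Type*} [AddCommGroup D] [Fintype D]
    (q : D → AddCircle (1 : ℚ))
    (hquad : ∀ (n : ℤ) (x : D), q (n • x) = (n ^ 2 : ℤ) • q x)
    (hbil : ∀ x y z : D, bil q (x + y) z = bil q x z + bil q y z)
    (hnd : ∀ x : D, (∀ y : D, bil q x y = 0) → x = 0)
    (hexp : ∃ k : ℕ, ∀ x : D, 2 ^ k • x = 0)
    (γ : D) (h : eV γ ∈ imUp q) :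
    ∃ H₁ H₂ : AddSubgroup D, H₁ ≠ H₂ ∧
      Nat.card H₁ = 2 ∧ Nat.card H₂ = 2 ∧
      (∀ x ∈ H₁, q x = 0) ∧ (∀ x ∈ H₂, q x = 0) ∧
      (∀ x ∈ H₁, bil q γ x = 0) ∧ (∀ x ∈ H₂, bil q γ x = 0) := by
  by_contra hcon
  obtain ⟨f, hfγ, hf⟩ := exists_alternating hbil (γ := γ) <| by
    intro x y hx hy hγx hγy
    by_contra hxy
    have aux {x : D} (hx : IsIsotropicInvolution q x) (hγx : bil q γ x = 0) :
        ∀ z ∈ AddSubgroup.zmultiples x, q z = 0 ∧ bil q γ z = 0 := by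
      intro z hz
      rcases hx.eq_zero_or_eq_of_mem_zmultiples hz with rfl | rfl
      · exact ⟨apply_zero hbil, bil_zero_right hbil γ⟩
      · exact ⟨hx.2.2, hγx⟩
    refine hcon ⟨AddSubgroup.zmultiples x, AddSubgroup.zmultiples y, fun h => ?_,
      hx.card_zmultiples, hy.card_zmultiples, fun z hz => (aux hx hγx z hz).1,
      fun z hz => (aux hy hγy z hz).1, fun z hz => (aux hx hγx z hz).2,
      fun z hz => (aux hy hγy z hz).2⟩
    have hxm : x ∈ AddSubgroup.zmultiples y := h ▸ AddSubgroup.mem_zmultiples x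
    exact (hy.eq_zero_or_eq_of_mem_zmultiples hxm).elim hx.1 hxy
  have h0 := sum_mul_eq_zero_of_mem_imUp hbil hexp hf h
  simp [eV, hfγ] at h0
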